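/- Let (W,S) be an irreducible Coxeter system (of arbitrary rank) and I a subset of S with ∅ ≠ I ≠ S. Then the normal core of the parabolic subgroup W_I in W is trivial: Core_W(W_I) = ⋂_{w∈W} wW_Iw⁻¹ = 1. -/

import Mathlib

namespace CoxeterSystem

variable {B W : Type*} [Group W] {M : CoxeterMatrix B} (cs : CoxeterSystem M W)

/-! ### The exchange property -/

open Classical in
/-- The permutation of pairs (group element, sign) that conjugates by a simple reflection and flips the
sign exactly at that reflection. -/
noncomputable def signedConj (i : B) : Equiv.Perm (W × ZMod 2) :=
  Function.Involutive.toPerm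
    (fun p ↦ (cs.simple i * p.1 * cs.simple i, p.2 + if p.1 = cs.simple i then 1 else 0)) <| by
    rintro ⟨t, ε⟩
    have h : cs.simple i * t * cs.simple i = cs.simple i ↔ t = cs.simple i := by
      rw [mul_eq_right, mul_eq_one_iff_eq_inv', inv_simple]
    simp only [h, add_assoc, CharTwo.add_self_eq_zero, add_zero]
    simp [mul_assoc]

open Classical in
theorem signedConj_apply (i : B) (t : W) (ε : ZMod 2) :
    cs.signedConj i (t, ε) =
      (cs.simple i * t * cs.simple i, ε + if t = cs.simple i then 1 else 0) :=
  rfl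

open Classical in
theorem signedConj_mul_pow_apply (i j : B) (p : ℕ) (t : W) (ε : ZMod 2) :
    ((cs.signedConj i * cs.signedConj j) ^ p) (t, ε) =
      ((cs.simple i * cs.simple j) ^ p * t * ((cs.simple i * cs.simple j) ^ p)⁻¹,
        ε + ∑ l ∈ Finset.range (2 * p),
          if t = cs.simple j * (cs.simple i * cs.simple j) ^ l then 1 else 0) := by
  induction p with
  | zero => simp
  | succ p ih =>
    set r := cs.simple i * cs.simple j with hr
    have hconj (p : ℕ) : cs.simple j * r ^ p = (r ^ p)⁻¹ * cs.simple j := by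
      have h : cs.simple j * r * (cs.simple j)⁻¹ = r⁻¹ := by simp [hr, mul_assoc]
      have h' := congrArg (· ^ p) h
      simp only [conj_pow, inv_pow] at h'
      rw [← h']
      simp [mul_assoc]
    have h_even : r ^ p * t * (r ^ p)⁻¹ = cs.simple j ↔ t = cs.simple j * r ^ (2 * p) := by
      rw [two_mul, pow_add, ← mul_assoc, hconj, mul_inv_eq_iff_eq_mul, mul_assoc (r ^ p)⁻¹,
        eq_inv_mul_iff_mul_eq]
    have h_odd : cs.simple j * (r ^ p * t * (r ^ p)⁻¹) * cs.simple j = cs.simple i ↔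
        t = cs.simple j * r ^ (2 * p + 1) := by
      have h1 : cs.simple j * r ^ (2 * p + 1) =
          (r ^ p)⁻¹ * (cs.simple j * cs.simple i * cs.simple j) * r ^ p := by
        rw [show 2 * p + 1 = p + 1 + p by ring, pow_add, ← mul_assoc, pow_succ, ← mul_assoc,
          hconj, hr]
        simp only [mul_assoc]
      rw [h1]
      constructor
      · intro h
        rw [← h]
        simp [mul_assoc]
      · rintro rfl
        simp [mul_assoc]
    rw [pow_succ', Equiv.Perm.mul_apply, ih]
    simp only [Equiv.Perm.mul_apply, signedConj_apply]
    rw [Prod.mk.injEq]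
    constructor
    · rw [pow_succ']
      simp [hr, mul_assoc]
    · rw [show 2 * (p + 1) = 2 * p + 1 + 1 by ring, Finset.sum_range_succ, Finset.sum_range_succ]
      simp only [h_even, h_odd]
      ring

theorem isLiftable_signedConj : M.IsLiftable cs.signedConj := by
  classical
  intro i j
  refine Equiv.ext fun ⟨t, ε⟩ ↦ ?_
  have hpow := cs.simple_mul_simple_pow i j
  rw [signedConj_mul_pow_apply, hpow, two_mul, Finset.sum_range_add]
  simp only [pow_add, hpow, one_mul, CharTwo.add_self_eq_zero]
  simp

theorem lift_signedConj_wordProd_apply (ω : List B) (t : W) (ε : ZMod 2)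
    (ht : t ∉ cs.rightInvSeq ω) :
    cs.lift ⟨cs.signedConj, cs.isLiftable_signedConj⟩ (cs.wordProd ω) (t, ε) =
      (cs.wordProd ω * t * (cs.wordProd ω)⁻¹, ε) := by
  induction ω with
  | nil => simp
  | cons i ω ih =>
    simp only [rightInvSeq, List.mem_cons, not_or] at ht
    have hne : cs.wordProd ω * t * (cs.wordProd ω)⁻¹ ≠ cs.simple i := by
      intro h
      apply ht.1
      rw [← h]
      simp [mul_assoc]
    rw [wordProd_cons, map_mul, Equiv.Perm.mul_apply, ih ht.2,
      lift_apply_simple]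
    rw [signedConj_apply, if_neg hne]
    simp [mul_assoc]

theorem simple_mem_rightInvSeq_of_isRightDescent {ω : List B} {i : B}
    (h : cs.IsRightDescent (cs.wordProd ω) i) : cs.simple i ∈ cs.rightInvSeq ω := by
  by_contra hω
  obtain ⟨ω', hred, hω'⟩ := cs.exists_isReduced (cs.wordProd ω * cs.simple i)
  have hi : cs.simple i ∉ cs.rightInvSeq ω' := by
    intro hmem
    have h' := (cs.isRightInversion_of_mem_rightInvSeq hred hmem).2
    rw [← hω', simple_mul_simple_cancel_right] at h'
    exact lt_asymm h h'
  have h1 := cs.lift_signedConj_wordProd_apply ω' _ 0 hi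
  rw [← hω', map_mul, Equiv.Perm.mul_apply, lift_apply_simple] at h1
  have h2 : cs.signedConj i (cs.simple i, 0) = (cs.simple i, 1) := by simp [signedConj_apply]
  rw [h2, lift_signedConj_wordProd_apply _ _ _ _ hω] at h1
  simp at h1

theorem simple_mem_leftInvSeq_of_isLeftDescent {ω : List B} {i : B}
    (h : cs.IsLeftDescent (cs.wordProd ω) i) : cs.simple i ∈ cs.leftInvSeq ω := by
  rw [← cs.isRightDescent_inv_iff, ← wordProd_reverse] at h
  simpa [rightInvSeq_reverse] using cs.simple_mem_rightInvSeq_of_isRightDescent h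

/-! ### The contragredient geometric representation -/

section Geometric

open Polynomial Polynomial.Chebyshev Real

theorem _root_.Module.reflection_mul_reflection_pow_eq_one {V : Type*} [AddCommGroup V]
    [Module ℝ V] {x y : V} {f g : Module.Dual ℝ V} (hf : f x = 2) (hg : g y = 2) {m : ℕ}
    (hm : 2 ≤ m) (hfy : f y = -2 * cos (π / m)) (hgx : g x = -2 * cos (π / m)) :
    (Module.reflection hf * Module.reflection hg) ^ m = 1 := by
  obtain rfl | hm := hm.eq_or_lt
  · ext z
    simp at hfy hgx
    simp [pow_two, Module.reflection_apply, hfy, hgx, hf, hg]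
    module
  set θ := π / m with hθ
  have hm0 : (0 : ℝ) < m := by positivity
  have hmθ : m * θ = π := by rw [hθ]; field_simp
  have hm3 : (3 : ℝ) ≤ m := by exact_mod_cast hm
  have hθ0 : 0 < θ := by positivity
  have hsin : sin (2 * θ) ≠ 0 := by
    refine (sin_pos_of_pos_of_lt_pi (by positivity) ?_).ne'
    nlinarith
  have ht : 2 * cos (2 * θ) = f y * g x - 2 := by
    rw [hfy, hgx, cos_two_mul]
    ring
  have hS (n : ℤ) : (S ℝ n).eval (2 * cos (2 * θ)) = sin ((n + 1) * (2 * θ)) / sin (2 * θ) := by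
    rw [eq_div_iff hsin, S_two_mul_real_cos]
  ext z
  rw [Module.reflection_mul_reflection_pow_apply hf hg m z _ ht]
  obtain ⟨k, rfl | rfl⟩ := Nat.even_or_odd' m
  · have h1 : (((2 * k : ℕ) : ℤ) - 2) / 2 = k - 1 := by omega
    have h2 : (((2 * k : ℕ) : ℤ) - 1) / 2 = k - 1 := by omega
    have h0 : (S ℝ (k - 1)).eval (2 * cos (2 * θ)) = 0 := by
      rw [hS]
      push_cast at hmθ ⊢
      rw [show ((k : ℝ) - 1 + 1) * (2 * θ) = π by linarith]
      simp
    rw [h1, h2, h0]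
    simp
  · have h1 : (((2 * k + 1 : ℕ) : ℤ) - 1) / 2 = k := by omega
    have h2 : (((2 * k + 1 : ℕ) : ℤ) - 3) / 2 = k - 1 := by omega
    have h3 : (((2 * k + 1 : ℕ) : ℤ)) / 2 = k := by omega
    have h4 : (((2 * k + 1 : ℕ) : ℤ) - 2) / 2 = k - 1 := by omega
    have h0 : (S ℝ k).eval (2 * cos (2 * θ)) + (S ℝ (k - 1)).eval (2 * cos (2 * θ)) = 0 := by
      rw [hS, hS]
      push_cast at hmθ ⊢
      rw [show ((k : ℝ) - 1 + 1) * (2 * θ) = π - θ by linarith,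
        show ((k : ℝ) + 1) * (2 * θ) = θ + π by linarith, sin_pi_sub, sin_add_pi]
      ring
    rw [h1, h2, h3, h4, h0]
    simp

/-- Twice the pairing of the simple root `i` with each simple root under the canonical bilinear
form. -/
noncomputable def _root_.CoxeterMatrix.geometricVector (M : CoxeterMatrix B) (i : B) : B → ℝ :=
  fun j ↦ -2 * cos (π / M i j)

theorem _root_.CoxeterMatrix.proj_geometricVector_self (M : CoxeterMatrix B) (i : B) :
    (LinearMap.proj i : Module.Dual ℝ (B → ℝ)) (M.geometricVector i) = 2 := by
  simp [CoxeterMatrix.geometricVector]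

/-- The simple reflections of the dual of the geometric representation. -/
noncomputable def _root_.CoxeterMatrix.geometricReflection (M : CoxeterMatrix B) (i : B) :
    (B → ℝ) ≃ₗ[ℝ] (B → ℝ) :=
  Module.reflection (M.proj_geometricVector_self i)

theorem _root_.CoxeterMatrix.geometricReflection_apply (M : CoxeterMatrix B) (i : B) (v : B → ℝ)
    (j : B) : M.geometricReflection i v j = v j + 2 * cos (π / M i j) * v i := by
  simp [CoxeterMatrix.geometricReflection, Module.reflection_apply,
    CoxeterMatrix.geometricVector]
  ring

theorem _root_.CoxeterMatrix.isLiftable_geometricReflection (M : CoxeterMatrix B) :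
    M.IsLiftable M.geometricReflection := by
  intro i j
  obtain rfl | hij := eq_or_ne i j
  · rw [M.diagonal, pow_one]
    exact mul_eq_one_iff_eq_inv.2 (Module.reflection_inv _).symm
  obtain h0 | h0 := eq_or_ne (M i j) 0
  · rw [h0, pow_zero]
  have h1 := M.off_diagonal i j hij
  refine Module.reflection_mul_reflection_pow_eq_one _ _ (by omega) ?_ ?_
  · simp [CoxeterMatrix.geometricVector, M.symmetric j i]
  · simp [CoxeterMatrix.geometricVector]

/-- The dual of the geometric representation. -/
noncomputable def geometricRep : W →* ((B → ℝ) ≃ₗ[ℝ] (B → ℝ)) :=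
  cs.lift ⟨M.geometricReflection, M.isLiftable_geometricReflection⟩

theorem geometricRep_simple (i : B) : cs.geometricRep (cs.simple i) = M.geometricReflection i :=
  cs.lift_apply_simple _ i

theorem eq_two_of_commute_simple {i j : B} (hij : i ≠ j)
    (h : Commute (cs.simple i) (cs.simple j)) : M i j = 2 := by
  classical
  have h' := congrArg cs.geometricRep h.eq
  rw [map_mul, map_mul, geometricRep_simple, geometricRep_simple] at h'
  have h'' := congrFun (DFunLike.congr_fun h' (Pi.single i 1)) j
  simp only [LinearEquiv.mul_apply, CoxeterMatrix.geometricReflection_apply, Pi.single_eq_same,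
    Pi.single_eq_of_ne hij.symm, M.diagonal, M.symmetric j i] at h''
  simp at h''
  have hcos : cos (π / M i j) = 0 := by linarith
  obtain h0 | h0 := eq_or_ne (M i j) 0
  · simp [h0] at hcos
  have h1 := M.off_diagonal i j hij
  by_contra h2
  have h3 : (3 : ℝ) ≤ M i j := by exact_mod_cast (show 3 ≤ M i j by omega)
  refine (cos_pos_of_mem_Ioo ⟨?_, ?_⟩).ne' hcos
  · have : 0 < π / M i j := by positivity
    linarith [pi_pos]
  · rw [div_lt_div_iff₀ (by linarith) (by norm_num)]
    nlinarith [pi_pos]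

end Geometric

/-! ### Standard parabolic subgroups -/

/-- The standard parabolic subgroup generated by a set of simple reflections. -/
def parabolic (J : Set B) : Subgroup W := Subgroup.closure (cs.simple '' J)

variable {cs} {J : Set B}

theorem simple_mem_parabolic {i : B} (hi : i ∈ J) : cs.simple i ∈ cs.parabolic J :=
  Subgroup.subset_closure ⟨i, hi, rfl⟩

theorem simple_mem_parabolic_iff {i : B} : cs.simple i ∈ cs.parabolic J ↔ i ∈ J := by
  classical
  refine ⟨fun h ↦ ?_, simple_mem_parabolic⟩
  by_contra hi
  have key (w : W) (hw : w ∈ cs.parabolic J) :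
      cs.geometricRep w (Pi.single i 1) = Pi.single i 1 := by
    induction hw using Subgroup.closure_induction with
    | mem x hx =>
      obtain ⟨j, hj, rfl⟩ := hx
      have hji : j ≠ i := fun h ↦ hi (h ▸ hj)
      ext k
      simp [geometricRep_simple, CoxeterMatrix.geometricReflection_apply, hji]
    | one => simp
    | mul x y _ _ hx hy => rw [map_mul, LinearEquiv.mul_apply, hy, hx]
    | inv x _ hx =>
      rw [map_inv]
      nth_rewrite 1 [← hx]
      exact LinearEquiv.symm_apply_apply _ _
  have h' := congrFun (key _ h) i
  rw [geometricRep_simple, CoxeterMatrix.geometricReflection_apply] at h'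
  norm_num at h'

theorem wordProd_mem_parabolic {ω : List B} (hω : ∀ i ∈ ω, i ∈ J) :
    cs.wordProd ω ∈ cs.parabolic J := by
  induction ω with
  | nil => simp [one_mem]
  | cons i ω ih =>
    rw [wordProd_cons]
    exact mul_mem (simple_mem_parabolic (hω i (by simp))) (ih fun j hj ↦ hω j (by simp [hj]))

theorem exists_word_of_mem_parabolic {w : W} (hw : w ∈ cs.parabolic J) :
    ∃ ω : List B, (∀ i ∈ ω, i ∈ J) ∧ cs.wordProd ω = w := by
  induction hw using Subgroup.closure_induction with
  | mem x hx =>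
    obtain ⟨i, hi, rfl⟩ := hx
    exact ⟨[i], by simpa using hi, by simp⟩
  | one => exact ⟨[], by simp, by simp⟩
  | mul x y _ _ hx hy =>
    obtain ⟨ω, hω, rfl⟩ := hx
    obtain ⟨ω', hω', rfl⟩ := hy
    refine ⟨ω ++ ω', fun i hi ↦ ?_, cs.wordProd_append ω ω'⟩
    exact (List.mem_append.1 hi).elim (hω i) (hω' i)
  | inv x _ hx =>
    obtain ⟨ω, hω, rfl⟩ := hx
    exact ⟨ω.reverse, by simpa using hω, by simp⟩

theorem mem_parabolic_of_mem_rightInvSeq {ω : List B} (hω : ∀ i ∈ ω, i ∈ J) {t : W}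
    (ht : t ∈ cs.rightInvSeq ω) : t ∈ cs.parabolic J := by
  induction ω with
  | nil => simp at ht
  | cons i ω ih =>
    have hω' : ∀ j ∈ ω, j ∈ J := fun j hj ↦ hω j (by simp [hj])
    obtain rfl | ht := List.mem_cons.1 ht
    · have h := wordProd_mem_parabolic (cs := cs) hω'
      exact mul_mem (mul_mem (inv_mem h) (simple_mem_parabolic (hω i (by simp)))) h
    · exact ih hω' ht

theorem mem_parabolic_of_mem_leftInvSeq {ω : List B} (hω : ∀ i ∈ ω, i ∈ J) {t : W}
    (ht : t ∈ cs.leftInvSeq ω) : t ∈ cs.parabolic J := by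
  refine mem_parabolic_of_mem_rightInvSeq (ω := ω.reverse) (by simpa using hω) ?_
  simpa [rightInvSeq_reverse] using ht

theorem mem_of_isLeftDescent_of_mem_parabolic {w : W} (hw : w ∈ cs.parabolic J) {i : B}
    (hi : cs.IsLeftDescent w i) : i ∈ J := by
  obtain ⟨ω, hω, rfl⟩ := exists_word_of_mem_parabolic hw
  exact simple_mem_parabolic_iff.1
    (mem_parabolic_of_mem_leftInvSeq hω (cs.simple_mem_leftInvSeq_of_isLeftDescent hi))

theorem IsReduced.isLeftDescent_cons {i : B} {ω : List B} (hω : cs.IsReduced (i :: ω)) :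
    cs.IsLeftDescent (cs.wordProd (i :: ω)) i := by
  have h := cs.length_wordProd_le ω
  have h' := hω.eq
  rw [List.length_cons] at h'
  rw [IsLeftDescent, h', wordProd_cons, simple_mul_simple_cancel_left]
  omega

theorem IsReduced.mem_of_wordProd_mem_parabolic {ω : List B} (hω : cs.IsReduced ω)
    (h : cs.wordProd ω ∈ cs.parabolic J) : ∀ i ∈ ω, i ∈ J := by
  induction ω with
  | nil => simp
  | cons i ω ih =>
    have hi : i ∈ J := mem_of_isLeftDescent_of_mem_parabolic h hω.isLeftDescent_cons
    have hω' : cs.wordProd ω ∈ cs.parabolic J := by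
      rw [wordProd_cons] at h
      exact (Subgroup.mul_mem_cancel_left _ (simple_mem_parabolic hi)).1 h
    have := ih (hω.drop 1) hω'
    simpa [hi] using this

theorem length_simple_mul_of_mem_parabolic {w : W} (hw : w ∈ cs.parabolic J) {i : B}
    (hi : i ∉ J) : cs.length (cs.simple i * w) = cs.length w + 1 :=
  cs.not_isLeftDescent_iff.1 fun h ↦ hi (mem_of_isLeftDescent_of_mem_parabolic hw h)

theorem length_mul_simple_of_mem_parabolic {w : W} (hw : w ∈ cs.parabolic J) {i : B}
    (hi : i ∉ J) : cs.length (w * cs.simple i) = cs.length w + 1 := by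
  have h := length_simple_mul_of_mem_parabolic (inv_mem hw) hi
  rwa [← cs.inv_simple, ← mul_inv_rev, length_inv, length_inv] at h

theorem commute_of_simple_conj_mem_parabolic {w : W} (hw : w ∈ cs.parabolic J) {i : B}
    (hi : i ∉ J) (h : cs.simple i * w * cs.simple i ∈ cs.parabolic J) :
    Commute (cs.simple i) w := by
  obtain ⟨ω, hω, rfl⟩ := exists_word_of_mem_parabolic hw
  have hdesc : cs.IsRightDescent (cs.wordProd (i :: ω)) i := by
    have h' := length_mul_simple_of_mem_parabolic h hi
    rw [simple_mul_simple_cancel_right] at h'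
    rw [IsRightDescent, wordProd_cons, h']
    omega
  obtain heq | hmem := List.mem_cons.1 (cs.simple_mem_rightInvSeq_of_isRightDescent hdesc)
  · rw [mul_assoc, eq_inv_mul_iff_mul_eq] at heq
    exact heq.symm
  · exact absurd (simple_mem_parabolic_iff.1 (mem_parabolic_of_mem_rightInvSeq hω hmem)) hi

theorem IsReduced.commute_simple_of_commute_wordProd {ω : List B} (hred : cs.IsReduced ω)
    (hω : ∀ j ∈ ω, j ∈ J) {i : B} (hi : i ∉ J) (h : Commute (cs.simple i) (cs.wordProd ω)) :
    ∀ j ∈ ω, Commute (cs.simple i) (cs.simple j) := by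
  induction ω with
  | nil => simp
  | cons j ω ih =>
    have hj : j ∈ J := hω j (by simp)
    have hred' : cs.IsReduced ω := hred.drop 1
    have hdesc : cs.IsLeftDescent (cs.wordProd (i :: j :: ω)) j := by
      rw [IsLeftDescent, wordProd_cons,
        length_simple_mul_of_mem_parabolic (wordProd_mem_parabolic hω) hi, hred.eq, h.eq,
        wordProd_cons, mul_assoc, simple_mul_simple_cancel_left, List.length_cons]
      have := cs.length_mul_le (cs.wordProd ω) (cs.simple i)
      rw [hred'.eq, length_simple] at this
      omega
    have hij : Commute (cs.simple i) (cs.simple j) := by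
      obtain heq | hmem := List.mem_cons.1 (cs.simple_mem_leftInvSeq_of_isLeftDescent hdesc)
      · exact heq ▸ Commute.refl _
      · obtain ⟨x, hx, hxj⟩ := List.mem_map.1 hmem
        refine commute_of_simple_conj_mem_parabolic (simple_mem_parabolic hj) hi ?_
        have : cs.simple i * cs.simple j * cs.simple i = x := by
          rw [← hxj]
          simp [mul_assoc]
        exact this ▸ mem_parabolic_of_mem_leftInvSeq hω hx
    have hrest : Commute (cs.simple i) (cs.wordProd ω) := by
      have := hij.mul_right h
      rwa [wordProd_cons, simple_mul_simple_cancel_left] at this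
    have := ih hred' (fun k hk ↦ hω k (by simp [hk])) hrest
    simpa [hij] using this

end CoxeterSystem


/-- In an irreducible Coxeter system (the Coxeter graph,
joining `s ≠ t` when `m(s,t) ≠ 2`, is connected), the normal core of a proper
nonempty standard parabolic subgroup `W_I` is trivial. -/
theorem stmt_13 {B W : Type*} [Group W] {M : CoxeterMatrix B}
    (cs : CoxeterSystem M W)
    (hirr : ∀ s t : B, Relation.ReflTransGen (fun a b => a ≠ b ∧ M a b ≠ 2) s t)
    (I : Set B) (hne : I.Nonempty) (hproper : I ≠ Set.univ) :
    (Subgroup.closure (cs.simple '' I)).normalCore = ⊥ := by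
  set N := (Subgroup.closure (cs.simple '' I)).normalCore
  have hNI : N ≤ cs.parabolic I := Subgroup.normalCore_le _
  have hnormal : N.Normal := Subgroup.normalCore_normal _
  obtain ⟨s, hs⟩ := (Set.ne_univ_iff_exists_notMem I).1 hproper
  let J : Set B := {t | ∃ ω : List B, cs.IsReduced ω ∧ cs.wordProd ω ∈ N ∧ t ∈ ω}
  have hNJ : N ≤ cs.parabolic J := by
    intro w hw
    obtain ⟨ω, hred, rfl⟩ := cs.exists_isReduced w
    exact CoxeterSystem.wordProd_mem_parabolic fun t ht ↦ ⟨ω, hred, hw, ht⟩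
  have hJI : J ⊆ I := by
    rintro t ⟨ω, hred, hω, ht⟩
    exact hred.mem_of_wordProd_mem_parabolic (hNI hω) t ht
  have hcomm : ∀ a ∈ J, ∀ b ∉ J, M a b = 2 := by
    rintro a ha b hb
    obtain ⟨ω, hred, hω, haω⟩ := id ha
    have hconj : cs.simple b * cs.wordProd ω * cs.simple b ∈ N := by
      simpa using hnormal.conj_mem _ hω (cs.simple b)
    have hc := CoxeterSystem.commute_of_simple_conj_mem_parabolic (hNJ hω) hb (hNJ hconj)
    have hab := hred.commute_simple_of_commute_wordProd
      (hred.mem_of_wordProd_mem_parabolic (hNJ hω)) hb hc a haω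
    exact cs.eq_two_of_commute_simple (fun h ↦ hb (h ▸ ha)) hab.symm
  have hempty : ∀ t, t ∉ J := by
    intro t ht
    suffices s ∈ J from hs (hJI this)
    clear hs
    induction hirr t s with
    | refl => exact ht
    | tail _ hbc hb => exact by_contra fun hc ↦ hbc.2 (hcomm _ hb _ hc)
  refine (Subgroup.eq_bot_iff_forall _).2 fun w hw ↦ ?_
  obtain ⟨ω, hred, rfl⟩ := cs.exists_isReduced w
  cases ω with
  | nil => simp
  | cons t ω => exact absurd ⟨_, hred, hw, by simp⟩ (hempty t)
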